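/- Product formula for Lucas-Pantograph exponentials: for x, y, u, v ∈ ℂ with u ≠ 0, v ≠ 0, if the series defining exp_{s,t}(x,u) and exp_{s,t}(y,v) converge absolutely, then the series Σ_{n=0}^{∞} (x ⊕_{u,v} y)^{(n)}/{n}_{s,t}! converges and Σ_{n=0}^{∞} (x ⊕_{u,v} y)^{(n)}/{n}_{s,t}! = exp_{s,t}(x,u)·exp_{s,t}(y,v). -/

import Mathlib

open scoped BigOperators

noncomputable section

/-- The Lucas sequence `{n}_{s,t}`. -/
def lucasSeq (s t : ℂ) : ℕ → ℂ
  | 0 => 0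
  | 1 => 1
  | n + 2 => s * lucasSeq s t (n + 1) + t * lucasSeq s t n

/-- The Lucastorial `{n}_{s,t}!`. -/
def lucasFact (s t : ℂ) : ℕ → ℂ
  | 0 => 1
  | n + 1 => lucasFact s t n * lucasSeq s t (n + 1)

/-- The Lucasnomial coefficient `{n choose k}_{s,t}`. -/
def lucasBinom (s t : ℂ) (n k : ℕ) : ℂ :=
  lucasFact s t n / (lucasFact s t k * lucasFact s t (n - k))

/-- The `(u,v)`-deformed Lucasnomial power `(x ⊕_{u,v} y)^{(n)}`. -/
def lucasPow (s t u v x y : ℂ) (n : ℕ) : ℂ :=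
  ∑ k ∈ Finset.range (n + 1),
    lucasBinom s t n k * u ^ ((n - k).choose 2) * v ^ (k.choose 2) * x ^ (n - k) * y ^ k

/-- The Lucas-derivative with respect to the roots `p = φ`, `q = φ'`. -/
def lucasDeriv (p q : ℂ) (f : ℂ → ℂ) (x : ℂ) : ℂ :=
  (f (p * x) - f (q * x)) / ((p - q) * x)

/-- The Lucas-derivative, extended by `0` at `0`, as an operator suitable for iteration. -/
def lucasDeriv0 (p q : ℂ) (f : ℂ → ℂ) : ℂ → ℂ :=
  fun x => if x = 0 then 0 else (f (p * x) - f (q * x)) / ((p - q) * x)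

/-- The Lucas-Pantograph exponential `exp_{s,t}(z,u)`. -/
def lucasExp (s t u z : ℂ) : ℂ :=
  ∑' n : ℕ, u ^ (n.choose 2) * z ^ n / lucasFact s t n

/-- The Lucas-Pantograph sine `sin_{s,t}(z,u)`. -/
def lucasSin (s t u z : ℂ) : ℂ :=
  ∑' n : ℕ, (-1 : ℂ) ^ n * u ^ ((2 * n + 1).choose 2) * z ^ (2 * n + 1) / lucasFact s t (2 * n + 1)

/-- The Lucas-Pantograph cosine `cos_{s,t}(z,u)`. -/
def lucasCos (s t u z : ℂ) : ℂ :=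
  ∑' n : ℕ, (-1 : ℂ) ^ n * u ^ ((2 * n).choose 2) * z ^ (2 * n) / lucasFact s t (2 * n)

/-- Product formula for Lucas-Pantograph exponentials. -/
theorem lucasExp_mul (s t : ℂ) (hs : s ≠ 0) (ht : t ≠ 0)
    (hL : ∀ n : ℕ, 1 ≤ n → lucasSeq s t n ≠ 0)
    (x y u v : ℂ) (hu : u ≠ 0) (hv : v ≠ 0)
    (hconvx : Summable fun n : ℕ => ‖u ^ (n.choose 2) * x ^ n / lucasFact s t n‖)
    (hconvy : Summable fun n : ℕ => ‖v ^ (n.choose 2) * y ^ n / lucasFact s t n‖) :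
    HasSum (fun n : ℕ => lucasPow s t u v x y n / lucasFact s t n)
      (lucasExp s t u x * lucasExp s t v y) := by
  have hF : ∀ n, lucasFact s t n ≠ 0 := by
    intro n
    induction n with
    | zero => simp [lucasFact]
    | succ k ih => exact mul_ne_zero ih (hL (k + 1) (by omega))
  have h := (summable_norm_sum_mul_range_of_summable_norm hconvy hconvx).of_norm.hasSum
  rw [← tsum_mul_tsum_eq_tsum_sum_range_of_summable_norm hconvy hconvx] at h
  rw [mul_comm]
  unfold lucasExp
  refine (congrArg (fun f => HasSum f _) (funext fun n => ?_)).mpr h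
  unfold lucasPow lucasBinom
  rw [Finset.sum_div]
  refine Finset.sum_congr rfl fun k _ => ?_
  have h1 := hF n
  have h2 := hF k
  have h3 := hF (n - k)
  field_simp
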